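/- Let L be a smooth real-valued function on an open set S ⊆ C satisfying the Lindström–Roček constraints ∇_I · ∇_J L = 0 and ∇_I × ∇_J L = 0⃗ for all I, J ∈ Fin m, and assume in addition the hyperkähler-cone constraints L₁(L) = 0 and L₀(L) = L on S. Then the Higgs field U_{IJ} := −½ ∂_{I,1}∂_{J,1} L satisfies, for all I, J ∈ Fin m: L_k U_{IJ} = 0 on S for k = 1, 2, 3 (invariance under collective rotations) and L₀ U_{IJ} = −U_{IJ} on S (homogeneity of degree −1). -/

import Mathlib

/-- The configuration space of `m` points in `ℝ³`. -/
abbrev Conf (m : ℕ) := Fin m → Fin 3 → ℝ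

/-- Standard basis vector `e_{K,i}` of the configuration space. -/
noncomputable def e {m : ℕ} (K : Fin m) (i : Fin 3) : Conf m :=
  Pi.single K (Pi.single i 1)

/-- The partial derivative `∂_{K,i}` along the basis vector `e_{K,i}`. -/
noncomputable def pd {m : ℕ} (K : Fin m) (i : Fin 3) (f : Conf m → ℝ) : Conf m → ℝ :=
  fun x => fderiv ℝ f x (e K i)

/-- Standard dot product on `ℝ³`. -/
noncomputable def dot3 (a b : Fin 3 → ℝ) : ℝ := ∑ i, a i * b i

/-- The Levi-Civita symbol on `Fin 3`, with `ε 0 1 2 = 1`. -/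
noncomputable def eps (k i j : Fin 3) : ℝ :=
  ((i : ℝ) - (k : ℝ)) * ((j : ℝ) - (k : ℝ)) * ((j : ℝ) - (i : ℝ)) / 2

/-- Standard cross product on `ℝ³`: `(a × b)_k = ∑_{i,j} ε_{kij} aᵢ bⱼ`. -/
noncomputable def cross3 (a b : Fin 3 → ℝ) : Fin 3 → ℝ :=
  fun k => ∑ i, ∑ j, eps k i j * a i * b j

/-- `∇_K f` : the `ℝ³`-valued gradient with respect to the `K`-th point. -/
noncomputable def grad {m : ℕ} (K : Fin m) (f : Conf m → ℝ) : Conf m → Fin 3 → ℝ :=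
  fun x i => pd K i f x

/-- The generator of simultaneous scalings: `L₀ f = ∑_K x⃗^K · ∇_K f`. -/
noncomputable def L0 {m : ℕ} (f : Conf m → ℝ) : Conf m → ℝ :=
  fun x => ∑ K, dot3 (x K) (grad K f x)

/-- The generators of rigid rotations: `Lᵢ f = −∑_K (x⃗^K × ∇_K f)ᵢ`,
for `i = 0, 1, 2` (playing the role of `1, 2, 3`). -/
noncomputable def Lrot {m : ℕ} (i : Fin 3) (f : Conf m → ℝ) : Conf m → ℝ :=
  fun x => -∑ K, cross3 (x K) (grad K f x) i

/-- The linear vector field `∑_K ∑_{i,j} A i j x^K_i ∂_{K,j}`, acting on functions. -/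
noncomputable def linField {m : ℕ} (A : Fin 3 → Fin 3 → ℝ) (f : Conf m → ℝ) : Conf m → ℝ :=
  fun x => ∑ K, ∑ i, ∑ j, A i j * (x K i * pd K j f x)

theorem L0_eq_linField {m : ℕ} (f : Conf m → ℝ) :
    L0 f = linField (fun i j => if i = j then 1 else 0) f := by
  funext x
  simp [L0, linField, dot3, grad]

theorem Lrot_eq_linField {m : ℕ} (k : Fin 3) (f : Conf m → ℝ) :
    Lrot k f = linField (fun i j => -eps k i j) f := by
  funext x
  simp [Lrot, linField, cross3, grad, mul_assoc]

section

variable {m : ℕ} {S : Set (Conf m)} {f g : Conf m → ℝ} {x : Conf m}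

theorem pd_congr (hS : IsOpen S) (h : ∀ y ∈ S, f y = g y) (hx : x ∈ S) (K : Fin m) (i : Fin 3) :
    pd K i f x = pd K i g x := by
  have : f =ᶠ[nhds x] g := Filter.eventually_of_mem (hS.mem_nhds hx) h
  simp only [pd, this.fderiv_eq]

theorem contDiffOn_pd (hS : IsOpen S) (hf : ContDiffOn ℝ (⊤ : ℕ∞) f S) (K : Fin m) (i : Fin 3) :
    ContDiffOn ℝ (⊤ : ℕ∞) (pd K i f) S :=
  (hf.fderiv_of_isOpen hS (m := (⊤ : ℕ∞)) (by simp)).clm_apply contDiffOn_const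

theorem differentiableAt_of_contDiffOn (hS : IsOpen S) (hf : ContDiffOn ℝ (⊤ : ℕ∞) f S)
    (hx : x ∈ S) : DifferentiableAt ℝ f x :=
  (hf.contDiffAt (hS.mem_nhds hx)).differentiableAt (by simp)

theorem pd_comm (hS : IsOpen S) (hf : ContDiffOn ℝ (⊤ : ℕ∞) f S) (hx : x ∈ S)
    (I J : Fin m) (i j : Fin 3) : pd I i (pd J j f) x = pd J j (pd I i f) x := by
  have hc := hf.contDiffAt (hS.mem_nhds hx)
  have hd : DifferentiableAt ℝ (fderiv ℝ f) x :=
    (hc.fderiv_right (m := (⊤ : ℕ∞)) (by simp)).differentiableAt (by simp)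
  have hsymm : IsSymmSndFDerivAt ℝ f x :=
    hc.isSymmSndFDerivAt (by
      rw [minSmoothness_of_isRCLikeNormedField]
      exact WithTop.coe_le_coe.mpr (le_top : (2 : ℕ∞) ≤ ⊤))
  have key (v w : Conf m) :
      fderiv ℝ (fun y => fderiv ℝ f y v) x w = fderiv ℝ (fderiv ℝ f) x w v := by
    rw [fderiv_clm_apply hd (differentiableAt_const v)]
    simp
  exact (key _ _).trans ((hsymm _ _).trans (key _ _).symm)

theorem pd_coord (K I : Fin m) (i j : Fin 3) (x : Conf m) :
    pd I i (fun y => y K j) x = if K = I ∧ j = i then 1 else 0 := by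
  have h : HasFDerivAt (fun y : Conf m => y K j)
      ((ContinuousLinearMap.proj (R := ℝ) (φ := fun _ : Fin 3 => ℝ) j).comp
        (ContinuousLinearMap.proj (R := ℝ) (φ := fun _ : Fin m => Fin 3 → ℝ) K)) x :=
    (((ContinuousLinearMap.proj (R := ℝ) (φ := fun _ : Fin 3 => ℝ) j).comp
      (ContinuousLinearMap.proj (R := ℝ) (φ := fun _ : Fin m => Fin 3 → ℝ) K))).hasFDerivAt
  simp only [pd, h.fderiv, e, ContinuousLinearMap.comp_apply, ContinuousLinearMap.proj_apply]
  by_cases hK : K = I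
  · subst hK
    simp [Pi.single_apply]
  · simp [hK]

theorem pd_add (hf : DifferentiableAt ℝ f x) (hg : DifferentiableAt ℝ g x) (I : Fin m) (i : Fin 3) :
    pd I i (fun y => f y + g y) x = pd I i f x + pd I i g x := by
  simp [pd, fderiv_fun_add hf hg]

theorem pd_const_mul (c : ℝ) (hf : DifferentiableAt ℝ f x) (I : Fin m) (i : Fin 3) :
    pd I i (fun y => c * f y) x = c * pd I i f x := by
  simp [pd, fderiv_const_mul hf]

theorem pd_mul (hf : DifferentiableAt ℝ f x) (hg : DifferentiableAt ℝ g x) (I : Fin m) (i : Fin 3) :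
    pd I i (fun y => f y * g y) x = f x * pd I i g x + pd I i f x * g x := by
  simp [pd, fderiv_fun_mul hf hg, mul_comm]

theorem pd_sum {ι : Type*} (s : Finset ι) (F : ι → Conf m → ℝ)
    (hF : ∀ a ∈ s, DifferentiableAt ℝ (F a) x) (I : Fin m) (i : Fin 3) :
    pd I i (fun y => ∑ a ∈ s, F a y) x = ∑ a ∈ s, pd I i (F a) x := by
  simp [pd, fderiv_fun_sum hF]

theorem contDiffOn_linField (hS : IsOpen S) (hf : ContDiffOn ℝ (⊤ : ℕ∞) f S)
    (A : Fin 3 → Fin 3 → ℝ) : ContDiffOn ℝ (⊤ : ℕ∞) (linField A f) S := by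
  refine ContDiffOn.sum fun K _ => ContDiffOn.sum fun i _ => ContDiffOn.sum fun j _ => ?_
  exact contDiffOn_const.mul
    ((contDiff_apply_apply ℝ ℝ K i).contDiffOn.mul (contDiffOn_pd hS hf K j))

theorem pd_linField (hS : IsOpen S) (hf : ContDiffOn ℝ (⊤ : ℕ∞) f S) (hx : x ∈ S)
    (A : Fin 3 → Fin 3 → ℝ) (I : Fin m) (i : Fin 3) :
    pd I i (linField A f) x = linField A (pd I i f) x + ∑ j, A i j * pd I j f x := by
  have hc (K : Fin m) (a : Fin 3) : DifferentiableAt ℝ (fun y : Conf m => y K a) x := by fun_prop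
  have hp (K : Fin m) (b : Fin 3) : DifferentiableAt ℝ (pd K b f) x :=
    differentiableAt_of_contDiffOn hS (contDiffOn_pd hS hf K b) hx
  have hm (K : Fin m) (a b : Fin 3) : DifferentiableAt ℝ (fun y => y K a * pd K b f y) x :=
    (hc K a).mul (hp K b)
  have ht (K : Fin m) (a b : Fin 3) :
      DifferentiableAt ℝ (fun y => A a b * (y K a * pd K b f y)) x := (hm K a b).const_mul _
  have hterm (K : Fin m) (a b : Fin 3) : pd I i (fun y => A a b * (y K a * pd K b f y)) x =
      A a b * (x K a * pd K b (pd I i f) x) +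
        if K = I then (if a = i then A a b * pd K b f x else 0) else 0 := by
    rw [pd_const_mul _ (hm K a b), pd_mul (hc K a) (hp K b), pd_coord, pd_comm hS hf hx I K i b]
    split_ifs <;> simp_all [mul_add]
  unfold linField
  rw [pd_sum _ _ fun K _ => .fun_sum fun a _ => .fun_sum fun b _ => ht K a b]
  simp_rw [pd_sum _ _ fun a _ => DifferentiableAt.fun_sum fun b _ => ht _ a b,
    pd_sum _ _ fun b _ => ht _ _ b, hterm, Finset.sum_add_distrib]
  congr 1
  rw [Finset.sum_eq_single I (fun K _ hK => by simp [hK]) (by simp),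
    Finset.sum_eq_single i (fun a _ ha => by simp [ha]) (by simp)]
  simp

theorem pd_pd_linField (hS : IsOpen S) (hf : ContDiffOn ℝ (⊤ : ℕ∞) f S) (hx : x ∈ S)
    (A : Fin 3 → Fin 3 → ℝ) (I J : Fin m) (i j : Fin 3) :
    pd I i (pd J j (linField A f)) x = linField A (pd I i (pd J j f)) x +
      ∑ l, A i l * pd I l (pd J j f) x + ∑ l, A j l * pd I i (pd J l f) x := by
  have hp (l : Fin 3) : DifferentiableAt ℝ (pd J l f) x :=
    differentiableAt_of_contDiffOn hS (contDiffOn_pd hS hf J l) hx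
  rw [pd_congr hS (fun y hy => pd_linField hS hf hy A J j) hx,
    pd_add (differentiableAt_of_contDiffOn hS
      (contDiffOn_linField hS (contDiffOn_pd hS hf J j) A) hx)
      (.fun_sum fun l _ => (hp l).const_mul _),
    pd_linField hS (contDiffOn_pd hS hf J j) hx,
    pd_sum _ _ fun l _ => (hp l).const_mul _]
  simp_rw [pd_const_mul _ (hp _)]

theorem linField_const_mul (c : ℝ) (hf : DifferentiableAt ℝ f x) (A : Fin 3 → Fin 3 → ℝ) :
    linField A (fun y => c * f y) x = c * linField A f x := by
  simp only [linField, pd_const_mul c hf, Finset.mul_sum]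
  refine Finset.sum_congr rfl fun K _ => Finset.sum_congr rfl fun i _ =>
    Finset.sum_congr rfl fun j _ => by ring

theorem pd_zero_fun (I : Fin m) (i : Fin 3) : pd I i (fun _ : Conf m => (0 : ℝ)) x = 0 := by
  simp [pd]

/-- A curl-free second derivative is symmetric in the spatial indices. -/
theorem pd_pd_swap_of_curl {I J : Fin m}
    (h : ∀ k : Fin 3, ∑ i : Fin 3, ∑ j : Fin 3, eps k i j * pd I i (pd J j f) x = 0)
    (i j : Fin 3) : pd I i (pd J j f) x = pd I j (pd J i f) x := by
  have h0 := h 0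
  have h1 := h 1
  have h2 := h 2
  simp [Fin.sum_univ_three, eps] at h0 h1 h2
  fin_cases i <;> fin_cases j <;> simp <;> linarith

end

/-- for an `L`-potential satisfying the Lindström–Roček
constraints together with the hyperkähler-cone constraints `L₁(L) = 0` and
`L₀(L) = L`, the Higgs field `U_{IJ} = −½ ∂_{I,1}∂_{J,1}L` is invariant under
collective rotations and homogeneous of degree `−1`
(indices `1,2,3` of the paper correspond to `0,1,2` in `Fin 3`). -/
theorem stmt10 {m : ℕ} (hm : 1 ≤ m) (S : Set (Conf m)) (hS : IsOpen S)
    (L : Conf m → ℝ) (hsmooth : ContDiffOn ℝ (⊤ : ℕ∞) L S)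
    (hLap : ∀ I J : Fin m, ∀ x ∈ S, ∑ i : Fin 3, pd I i (pd J i L) x = 0)
    (hcurl : ∀ I J : Fin m, ∀ x ∈ S, ∀ k : Fin 3,
      ∑ i : Fin 3, ∑ j : Fin 3, eps k i j * pd I i (pd J j L) x = 0)
    (hHKC1 : ∀ x ∈ S, Lrot 0 L x = 0)
    (hHKC0 : ∀ x ∈ S, L0 L x = L x)
    (UIJ : Fin m → Fin m → Conf m → ℝ)
    (hUIJ : ∀ I J, UIJ I J = fun x => -(1/2) * pd I 0 (pd J 0 L) x) :
    ∀ I J : Fin m, ∀ x ∈ S,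
      (∀ k : Fin 3, Lrot k (UIJ I J) x = 0) ∧
      L0 (UIJ I J) x = -(UIJ I J x) := by
  intro I J x hx
  have hW (i j : Fin 3) : ContDiffOn ℝ (⊤ : ℕ∞) (pd I i (pd J j L)) S :=
    contDiffOn_pd hS (contDiffOn_pd hS hsmooth J j) I i
  have hdW (i j : Fin 3) : DifferentiableAt ℝ (pd I i (pd J j L)) x :=
    differentiableAt_of_contDiffOn hS (hW i j) hx
  have hswap (K M : Fin m) (y : Conf m) (hy : y ∈ S) (i j : Fin 3) :
      pd K i (pd M j L) y = pd K j (pd M i L) y :=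
    pd_pd_swap_of_curl (hcurl K M y hy) i j
  have hlast (K : Fin m) (k i j : Fin 3) :
      pd K k (pd I i (pd J j L)) x = pd K k (pd I j (pd J i L)) x :=
    pd_congr hS (fun y hy => hswap I J y hy i j) hx K k
  have hfirst (K : Fin m) (k i j : Fin 3) :
      pd K k (pd I i (pd J j L)) x = pd K i (pd I k (pd J j L)) x := by
    have hout (a b : Fin 3) :
        pd K a (pd I b (pd J j L)) x = pd J j (pd K a (pd I b L)) x := by
      rw [pd_congr hS (fun y hy => pd_comm hS hsmooth hy I J b j) hx,
        pd_comm hS (contDiffOn_pd hS hsmooth I b) hx]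
    rw [hout, hout, pd_congr hS (fun y hy => hswap K I y hy k i) hx]
  have htrace (K : Fin m) (k : Fin 3) : pd K k (pd I 0 (pd J 0 L)) x
      + pd K k (pd I 1 (pd J 1 L)) x + pd K k (pd I 2 (pd J 2 L)) x = 0 := by
    have h := pd_congr hS (fun y hy => hLap I J y hy) hx K k
    rw [pd_sum _ _ fun i _ => hdW i i, pd_zero_fun, Fin.sum_univ_three] at h
    exact h
  have hscale (i j : Fin 3) :
      L0 (pd I i (pd J j L)) x = -pd I i (pd J j L) x := by
    have h := pd_pd_linField hS hsmooth hx (fun i j => if i = j then 1 else 0) I J i j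
    rw [← L0_eq_linField, ← L0_eq_linField,
      pd_congr hS (fun y hy => pd_congr hS hHKC0 hy J j) hx] at h
    simp at h
    linarith
  have hrot (i j : Fin 3) : Lrot 0 (pd I i (pd J j L)) x =
      ∑ l, eps 0 i l * pd I l (pd J j L) x + ∑ l, eps 0 j l * pd I i (pd J l L) x := by
    have h := pd_pd_linField hS hsmooth hx (fun i j => -eps 0 i j) I J i j
    rw [← Lrot_eq_linField, ← Lrot_eq_linField,
      pd_congr hS (fun y hy => pd_congr hS hHKC1 hy J j) hx,
      pd_congr hS (fun y _ => pd_zero_fun J j) hx, pd_zero_fun] at h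
    simp only [neg_mul, Finset.sum_neg_distrib] at h
    linarith
  have hrot0 : Lrot 0 (pd I 0 (pd J 0 L)) x = 0 := by
    simpa [Fin.sum_univ_three, eps] using hrot 0 0
  have hrot1 : Lrot 1 (pd I 0 (pd J 0 L)) x = 0 := by
    have h : Lrot 1 (pd I 0 (pd J 0 L)) x =
        L0 (pd I 0 (pd J 2 L)) x + Lrot 0 (pd I 0 (pd J 1 L)) x := by
      simp only [Lrot, L0, ← Finset.sum_add_distrib, ← Finset.sum_neg_distrib]
      refine Finset.sum_congr rfl fun K _ => ?_
      simp [cross3, dot3, grad, eps, Fin.sum_univ_three]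
      linear_combination x K 0 * (hfirst K 2 0 0 + hlast K 0 2 0)
        - x K 1 * (hfirst K 1 0 2 + hlast K 0 1 2 + hfirst K 0 2 1)
        - x K 2 * (htrace K 0 + hfirst K 2 0 2 + hfirst K 1 0 1)
    have h1 := hrot 0 1
    simp [Fin.sum_univ_three, eps] at h1
    rw [h, hscale, h1]
    ring
  have hrot2 : Lrot 2 (pd I 0 (pd J 0 L)) x = 0 := by
    have h : Lrot 2 (pd I 0 (pd J 0 L)) x =
        Lrot 0 (pd I 0 (pd J 2 L)) x - L0 (pd I 0 (pd J 1 L)) x := by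
      simp only [Lrot, L0, sub_eq_add_neg, ← Finset.sum_add_distrib, ← Finset.sum_neg_distrib]
      refine Finset.sum_congr rfl fun K _ => ?_
      simp [cross3, dot3, grad, eps, Fin.sum_univ_three]
      linear_combination -x K 0 * (hfirst K 1 0 0 + hlast K 0 1 0)
        + x K 1 * (htrace K 0 + hfirst K 2 0 2 + hfirst K 1 0 1)
        - x K 2 * (hfirst K 1 0 2 + hlast K 0 1 2 + hfirst K 0 2 1)
    have h2 := hrot 0 2
    simp [Fin.sum_univ_three, eps] at h2
    rw [h, hscale, h2]
    ring
  have hrotAll : ∀ k, Lrot k (pd I 0 (pd J 0 L)) x = 0 := by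
    intro k
    fin_cases k
    exacts [hrot0, hrot1, hrot2]
  rw [hUIJ]
  refine ⟨fun k => ?_, ?_⟩
  · rw [Lrot_eq_linField, linField_const_mul _ (hdW 0 0), ← Lrot_eq_linField, hrotAll, mul_zero]
  · rw [L0_eq_linField, linField_const_mul _ (hdW 0 0), ← L0_eq_linField, hscale, mul_neg]
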